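/- Suppose X* is a global minimizer of the KS minimization problem (with the special exchange correlation functional). If the gap assumption holds at H(X*) with a constant δ satisfying δ > p(‖L†‖₂ − γ/3), then X* is an orthonormal eigenbasis of H(X*) corresponding to its p smallest eigenvalues; that is, H(X*)X* = X*Λ* with Λ* := (X*)ᵀH(X*)X*, and the column space of X* is the invariant subspace of H(X*) spanned by eigenvectors of its p smallest eigenvalues (equivalently, tr((X*)ᵀH(X*)X*) = λ₁(H(X*)) + … + λ_p(H(X*))). -/

import Mathlib

open Matrix Filter

/-- Spectral (ℓ² operator) norm of a real matrix. -/
noncomputable def specNorm {m k : ℕ} (A : Matrix (Fin m) (Fin k) ℝ) : ℝ :=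
  ‖LinearMap.toContinuousLinearMap (Matrix.toEuclideanLin A)‖

/-- Eigenvalues of a real symmetric matrix, sorted in ascending order
(junk value `0` if the matrix is not symmetric). -/
noncomputable def eig {n : ℕ} (A : Matrix (Fin n) (Fin n) ℝ) : Fin n → ℝ :=
  if h : A.IsHermitian then h.eigenvalues ∘ (Tuple.sort h.eigenvalues) else 0

/-- Charge density `ρ(X) = diag(XXᵀ)`. -/
noncomputable def rhoX {ι : Type*} [Fintype ι] {p : ℕ} (X : Matrix ι (Fin p) ℝ) : ι → ℝ :=
  fun i => ∑ j, X i j ^ 2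

/-- KS total energy with the special exchange correlation functional
`eᵀε_xc(ρ) = −(3/4)γ ρᵀρ^{1/3}`. -/
noncomputable def En {ι : Type*} [Fintype ι] {p : ℕ} (L Vion Ld : Matrix ι ι ℝ) (γ : ℝ)
    (X : Matrix ι (Fin p) ℝ) : ℝ :=
  (1 / 4) * Matrix.trace (Xᵀ * L * X) + (1 / 2) * Matrix.trace (Xᵀ * Vion * X)
    + (1 / 4) * (rhoX X ⬝ᵥ Ld.mulVec (rhoX X))
    - (3 / 8) * γ * (rhoX X ⬝ᵥ fun i => (rhoX X i) ^ ((1 : ℝ) / 3))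

/-- KS Hamiltonian with the special exchange correlation functional:
`H(X) = (1/2)L + V_ion + Diag(L†ρ) − γ Diag(ρ^{1/3})`. -/
noncomputable def HXmat {ι : Type*} [Fintype ι] [DecidableEq ι] {p : ℕ}
    (L Vion Ld : Matrix ι ι ℝ) (γ : ℝ) (X : Matrix ι (Fin p) ℝ) : Matrix ι ι ℝ :=
  (1 / 2 : ℝ) • L + Vion + Matrix.diagonal (Ld.mulVec (rhoX X))
    - γ • Matrix.diagonal (fun i => (rhoX X i) ^ ((1 : ℝ) / 3))

/-- Strong convexity estimate for `t ↦ t ^ (4 / 3)` on `[0, 1]`, in terms of cube roots. -/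
lemma bregman_four_thirds_cube {x y : ℝ} (hx : 0 ≤ x) (hx1 : x ≤ 1) (hy : 0 ≤ y) (hy1 : y ≤ 1) :
    2 / 9 * (x ^ 3 - y ^ 3) ^ 2 ≤ x ^ 3 * x - y ^ 3 * y - 4 / 3 * y * (x ^ 3 - y ^ 3) := by
  have key : 2 * (x ^ 2 + x * y + y ^ 2) ^ 2 ≤ 3 * (3 * x ^ 2 + 2 * x * y + y ^ 2) := by
    rcases le_total y x with h | h
    · have hq : x ^ 2 + x * y + y ^ 2 ≤ 3 := by nlinarith
      have hq0 : 0 ≤ x ^ 2 + x * y + y ^ 2 := by positivity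
      nlinarith
    · have h1 : 0 ≤ (y - x) * (2 * x ^ 3 + 6 * x ^ 2 * y + 3 * x * y ^ 2 + y ^ 3) :=
        mul_nonneg (sub_nonneg.2 h) (by positivity)
      have h2 : y ^ 2 * (9 * x ^ 2 + 6 * x * y + 3 * y ^ 2)
          ≤ 1 * (9 * x ^ 2 + 6 * x * y + 3 * y ^ 2) :=
        mul_le_mul_of_nonneg_right (by nlinarith) (by positivity)
      nlinarith
  nlinarith [mul_le_mul_of_nonneg_left key (sq_nonneg (x - y))]

lemma bregman_four_thirds {a b : ℝ} (ha : 0 ≤ a) (ha1 : a ≤ 1) (hb : 0 ≤ b) (hb1 : b ≤ 1) :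
    2 / 9 * (a - b) ^ 2 ≤ a * a ^ ((1 : ℝ) / 3) - b * b ^ ((1 : ℝ) / 3)
      - 4 / 3 * b ^ ((1 : ℝ) / 3) * (a - b) := by
  have hcube : ∀ {t : ℝ}, 0 ≤ t → (t ^ ((1 : ℝ) / 3)) ^ 3 = t := fun {t} ht => by
    rw [← Real.rpow_natCast, ← Real.rpow_mul ht]; norm_num
  have h := bregman_four_thirds_cube (Real.rpow_nonneg ha (1 / 3))
    (Real.rpow_le_one ha ha1 (by norm_num)) (Real.rpow_nonneg hb (1 / 3))
    (Real.rpow_le_one hb hb1 (by norm_num))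
  rwa [hcube ha, hcube hb] at h

/-- The Moore–Penrose pseudoinverse of a symmetric matrix is symmetric. -/
lemma transpose_pseudoinverse_eq {n : ℕ} {L Ld : Matrix (Fin n) (Fin n) ℝ} (hL : Lᵀ = L)
    (hMP1 : L * Ld * L = L) (hMP2 : Ld * L * Ld = Ld)
    (hMP3 : (L * Ld)ᵀ = L * Ld) (hMP4 : (Ld * L)ᵀ = Ld * L) : Ldᵀ = Ld := by
  have e3 : Ldᵀ * L = L * Ld := by rw [← hMP3, transpose_mul, hL]
  have e4 : L * Ldᵀ = Ld * L := by rw [← hMP4, transpose_mul, hL]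
  have t1 : L * Ldᵀ * L = L := by
    have := congrArg transpose hMP1
    simpa [transpose_mul, hL, Matrix.mul_assoc] using this
  have t2 : Ldᵀ * L * Ldᵀ = Ldᵀ := by
    have := congrArg transpose hMP2
    simpa [transpose_mul, hL, Matrix.mul_assoc] using this
  have hleft : Ld * L = Ldᵀ * L := by
    have h : Ld * L = (Ld * L) * (Ldᵀ * L) := by
      rw [Matrix.mul_assoc, ← Matrix.mul_assoc L, t1]
    calc Ld * L = (Ld * L)ᵀ := hMP4.symm
      _ = ((Ld * L) * (Ldᵀ * L))ᵀ := by rw [← h]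
      _ = (L * Ld) * (Ld * L) := by rw [transpose_mul, hMP4, e3, hMP3]
      _ = (Ldᵀ * L) * (Ld * L) := by rw [e3]
      _ = Ldᵀ * (L * Ld * L) := by simp only [Matrix.mul_assoc]
      _ = Ldᵀ * L := by rw [hMP1]
  have hright : L * Ld = L * Ldᵀ := by rw [← e3, ← hleft, e4]
  calc Ldᵀ = Ldᵀ * L * Ldᵀ := t2.symm
    _ = Ld * (L * Ldᵀ) := by rw [← hleft, Matrix.mul_assoc]
    _ = Ld := by rw [← hright, ← Matrix.mul_assoc, hMP2]

lemma dotProduct_mulVec_le_specNorm {n : ℕ} (A : Matrix (Fin n) (Fin n) ℝ) (d : Fin n → ℝ) :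
    d ⬝ᵥ A.mulVec d ≤ specNorm A * ∑ i, d i ^ 2 := by
  have h1 := real_inner_le_norm (WithLp.toLp 2 d)
    (LinearMap.toContinuousLinearMap (Matrix.toEuclideanLin A) (WithLp.toLp 2 d))
  have h2 := (LinearMap.toContinuousLinearMap (Matrix.toEuclideanLin A)).le_opNorm
    (WithLp.toLp 2 d)
  have h3 : ∑ i, d i ^ 2 = ‖WithLp.toLp 2 d‖ ^ 2 := by
    simp [EuclideanSpace.norm_sq_eq]
  have h4 : inner ℝ (WithLp.toLp 2 d)
      (LinearMap.toContinuousLinearMap (Matrix.toEuclideanLin A) (WithLp.toLp 2 d))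
      = d ⬝ᵥ A.mulVec d := by
    simp [PiLp.inner_apply, dotProduct, mul_comm]
  rw [h3, ← h4, specNorm]
  nlinarith [norm_nonneg (WithLp.toLp 2 d)]

lemma rhoX_eq_mul_transpose {n p : ℕ} (X : Matrix (Fin n) (Fin p) ℝ) (i : Fin n) :
    rhoX X i = (X * Xᵀ) i i := by
  simp [rhoX, Matrix.mul_apply, sq]

lemma rhoX_nonneg {n p : ℕ} (X : Matrix (Fin n) (Fin p) ℝ) (i : Fin n) : 0 ≤ rhoX X i :=
  Finset.sum_nonneg fun _ _ => sq_nonneg _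

/-- Each diagonal entry of the projector `XXᵀ` is the squared norm of its row. -/
lemma rhoX_eq_sum_sq {n p : ℕ} {X : Matrix (Fin n) (Fin p) ℝ} (hX : Xᵀ * X = 1) (i : Fin n) :
    rhoX X i = ∑ j, (X * Xᵀ) i j ^ 2 := by
  have hidem : (X * Xᵀ) * (X * Xᵀ) = X * Xᵀ := by
    rw [Matrix.mul_assoc, ← Matrix.mul_assoc Xᵀ, hX, Matrix.one_mul]
  have hsymm : (X * Xᵀ)ᵀ = X * Xᵀ := by simp
  rw [rhoX_eq_mul_transpose, ← hidem, Matrix.mul_apply, hidem]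
  refine Finset.sum_congr rfl fun j _ => ?_
  rw [sq, ← Matrix.transpose_apply (X * Xᵀ) i j, hsymm]

lemma rhoX_le_one {n p : ℕ} {X : Matrix (Fin n) (Fin p) ℝ} (hX : Xᵀ * X = 1) (i : Fin n) :
    rhoX X i ≤ 1 := by
  have h := rhoX_eq_sum_sq hX i
  have h2 := Finset.single_le_sum (f := fun j => (X * Xᵀ) i j ^ 2)
    (fun j _ => sq_nonneg _) (Finset.mem_univ i)
  simp only [← h, ← rhoX_eq_mul_transpose] at h2
  nlinarith [rhoX_nonneg X i]

lemma sum_rhoX {n p : ℕ} {X : Matrix (Fin n) (Fin p) ℝ} (hX : Xᵀ * X = 1) :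
    ∑ i, rhoX X i = p := by
  have h : ∑ i, rhoX X i = (X * Xᵀ).trace := by
    simp only [rhoX_eq_mul_transpose, Matrix.trace, Matrix.diag_apply]
  rw [h, Matrix.trace_mul_comm, hX]; simp

lemma trace_transpose_mul_diagonal_mul {n p : ℕ} (v : Fin n → ℝ) (X : Matrix (Fin n) (Fin p) ℝ) :
    (Xᵀ * diagonal v * X).trace = ∑ i, v i * rhoX X i := by
  rw [Matrix.mul_assoc, Matrix.trace_mul_comm, Matrix.mul_assoc]
  simp only [Matrix.trace, Matrix.diag_apply, Matrix.diagonal_mul, rhoX_eq_mul_transpose]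

/-- The energy difference is bounded by its linearization plus a quadratic in the densities. -/
lemma En_sub_le {n p : ℕ} {L Vion Ld : Matrix (Fin n) (Fin n) ℝ} (hLd : Ldᵀ = Ld) {γ : ℝ}
    (hγ : 0 ≤ γ) {X Y : Matrix (Fin n) (Fin p) ℝ} (hX : Xᵀ * X = 1) (hY : Yᵀ * Y = 1) :
    En L Vion Ld γ Y - En L Vion Ld γ X ≤
      1 / 2 * ((Yᵀ * HXmat L Vion Ld γ X * Y).trace - (Xᵀ * HXmat L Vion Ld γ X * X).trace)
        + 1 / 4 * (specNorm Ld - γ / 3) * ∑ i, (rhoX Y i - rhoX X i) ^ 2 := by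
  have htr : ∀ Z : Matrix (Fin n) (Fin p) ℝ, (Zᵀ * HXmat L Vion Ld γ X * Z).trace =
      1 / 2 * (Zᵀ * L * Z).trace + (Zᵀ * Vion * Z).trace + ∑ i, Ld.mulVec (rhoX X) i * rhoX Z i
        - γ * ∑ i, rhoX X i ^ ((1 : ℝ) / 3) * rhoX Z i := fun Z => by
    rw [HXmat, ← trace_transpose_mul_diagonal_mul, ← trace_transpose_mul_diagonal_mul]
    simp [Matrix.mul_add, Matrix.add_mul, Matrix.mul_sub, Matrix.sub_mul]
  have hxc : 2 / 9 * ∑ i, (rhoX Y i - rhoX X i) ^ 2 ≤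
      (rhoX Y ⬝ᵥ fun i => rhoX Y i ^ ((1 : ℝ) / 3)) - (rhoX X ⬝ᵥ fun i => rhoX X i ^ ((1 : ℝ) / 3))
        - 4 / 3 * (∑ i, rhoX X i ^ ((1 : ℝ) / 3) * rhoX Y i
          - ∑ i, rhoX X i ^ ((1 : ℝ) / 3) * rhoX X i) := by
    simp only [dotProduct, ← Finset.sum_sub_distrib, Finset.mul_sum]
    refine Finset.sum_le_sum fun i _ => ?_
    have := bregman_four_thirds (rhoX_nonneg Y i) (rhoX_le_one hY i) (rhoX_nonneg X i)
      (rhoX_le_one hX i)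
    linarith
  have hhartree := dotProduct_mulVec_le_specNorm Ld (rhoX Y - rhoX X)
  have hcomm : rhoX X ⬝ᵥ Ld.mulVec (rhoX Y) = rhoX Y ⬝ᵥ Ld.mulVec (rhoX X) := by
    rw [Matrix.dotProduct_mulVec, ← Matrix.mulVec_transpose, hLd, dotProduct_comm]
  have hsum : ∀ Z : Matrix (Fin n) (Fin p) ℝ,
      ∑ i, Ld.mulVec (rhoX X) i * rhoX Z i = rhoX Z ⬝ᵥ Ld.mulVec (rhoX X) := fun Z => by
    rw [dotProduct_comm]; rfl
  simp only [Matrix.mulVec_sub, sub_dotProduct, dotProduct_sub, hcomm, Pi.sub_apply] at hhartree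
  rw [htr, htr, hsum, hsum, En, En]
  nlinarith [mul_le_mul_of_nonneg_left hxc hγ]

lemma sum_castLE {n p : ℕ} (h : p ≤ n) (f : Fin n → ℝ) :
    ∑ k : Fin p, f (Fin.castLE h k) = ∑ k : Fin n, if (k : ℕ) < p then f k else 0 := by
  obtain ⟨m, rfl⟩ := Nat.exists_eq_add_of_le h
  rw [Fin.sum_univ_add]
  simp [Fin.castAdd]

/-- Excess of a weighted sum of ascending reals over the sum of the `p` smallest ones. -/
lemma weighted_sum_sub_sum_smallest {n p : ℕ} (hpn : p < n) (l w : Fin n → ℝ) (a b : ℝ)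
    (hw : ∑ k, w k = p) :
    ∑ k, l k * w k - ∑ k : Fin p, l (Fin.castLE hpn.le k) =
      (∑ k : Fin n, if (k : ℕ) < p then (a - l k) * (1 - w k) else (l k - b) * w k)
        + (b - a) * (p - ∑ k : Fin p, w (Fin.castLE hpn.le k)) := by
  have hone : (p : ℝ) = ∑ k : Fin n, if (k : ℕ) < p then (1 : ℝ) else 0 := by
    rw [← sum_castLE hpn.le (fun _ => (1 : ℝ))]; simp
  have hb : b * (p - ∑ k : Fin p, w (Fin.castLE hpn.le k))
      = ∑ k : Fin n, if (k : ℕ) < p then 0 else b * w k := by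
    rw [← hw, sum_castLE, ← Finset.sum_sub_distrib, Finset.mul_sum]
    refine Finset.sum_congr rfl fun k _ => ?_
    split_ifs <;> ring
  have ha : a * (p - ∑ k : Fin p, w (Fin.castLE hpn.le k))
      = ∑ k : Fin n, if (k : ℕ) < p then a * (1 - w k) else 0 := by
    rw [hone, sum_castLE, ← Finset.sum_sub_distrib, Finset.mul_sum]
    refine Finset.sum_congr rfl fun k _ => ?_
    split_ifs <;> ring
  rw [sub_mul b a, hb, ha, sum_castLE, ← Finset.sum_sub_distrib, ← Finset.sum_sub_distrib,
    ← Finset.sum_add_distrib]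
  refine Finset.sum_congr rfl fun k _ => ?_
  split_ifs <;> ring

lemma eig_monotone {n : ℕ} {A : Matrix (Fin n) (Fin n) ℝ} (hA : A.IsHermitian) :
    Monotone (eig A) := by
  rw [eig, dif_pos hA]; exact Tuple.monotone_sort _

/-- Spectral decomposition with ascending eigenvalues. -/
lemma exists_orthogonal_eig {n : ℕ} {A : Matrix (Fin n) (Fin n) ℝ} (hA : A.IsHermitian) :
    ∃ U : Matrix (Fin n) (Fin n) ℝ, Uᵀ * U = 1 ∧ U * Uᵀ = 1 ∧
      A = U * diagonal (eig A) * Uᵀ := by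
  set s := Tuple.sort hA.eigenvalues
  set V : Matrix (Fin n) (Fin n) ℝ := (hA.eigenvectorUnitary : Matrix (Fin n) (Fin n) ℝ)
  have hUU : (V.submatrix id s)ᵀ * V.submatrix id s = 1 := by
    have h : Vᵀ * V = 1 := by
      have := Unitary.coe_star_mul_self hA.eigenvectorUnitary
      rwa [Matrix.star_eq_conjTranspose, Matrix.conjTranspose_eq_transpose_of_trivial] at this
    rw [Matrix.transpose_submatrix, ← Matrix.submatrix_mul _ _ _ id _ Function.bijective_id, h]
    exact Matrix.submatrix_one_equiv s
  refine ⟨V.submatrix id s, hUU, mul_eq_one_comm.1 hUU, ?_⟩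
  have hspec : A = V * diagonal hA.eigenvalues * Vᵀ := by
    have := hA.spectral_theorem
    simpa [Unitary.conjStarAlgAut_apply, Matrix.star_eq_conjTranspose,
      Matrix.conjTranspose_eq_transpose_of_trivial, Function.comp_def] using this
  have hd : diagonal (eig A) = (diagonal hA.eigenvalues).submatrix s s := by
    rw [eig, dif_pos hA, Matrix.submatrix_diagonal_equiv]
  rw [hd, Matrix.transpose_submatrix, Matrix.submatrix_mul_equiv, Matrix.submatrix_mul_equiv,
    ← hspec, Matrix.submatrix_id_id]

/-- The squared Frobenius distance of two projectors bounds that of their diagonals. -/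
lemma sum_sq_rhoX_sub_le {n p : ℕ} {X Y : Matrix (Fin n) (Fin p) ℝ} (hX : Xᵀ * X = 1)
    (hY : Yᵀ * Y = 1) :
    ∑ i, (rhoX Y i - rhoX X i) ^ 2 ≤ 2 * (p - ∑ k, rhoX (Yᵀ * X) k) := by
  have hentry : ∑ i, (rhoX Y i - rhoX X i) ^ 2 ≤
      ∑ i, ∑ j, ((Y * Yᵀ) i j - (X * Xᵀ) i j) ^ 2 := by
    refine Finset.sum_le_sum fun i _ => ?_
    rw [rhoX_eq_mul_transpose, rhoX_eq_mul_transpose]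
    exact Finset.single_le_sum (f := fun j => ((Y * Yᵀ) i j - (X * Xᵀ) i j) ^ 2)
      (fun j _ => sq_nonneg _) (Finset.mem_univ i)
  have hcross : ∑ i, ∑ j, (Y * Yᵀ) i j * (X * Xᵀ) i j = ∑ k, rhoX (Yᵀ * X) k := by
    have h1 : ∑ i, ∑ j, (Y * Yᵀ) i j * (X * Xᵀ) i j = ((Y * Yᵀ) * (X * Xᵀ)ᵀ).trace := by
      simp only [Matrix.trace, Matrix.diag_apply, Matrix.mul_apply (M := Y * Yᵀ),
        Matrix.transpose_apply (X * Xᵀ)]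
    have h2 : ∑ k, rhoX (Yᵀ * X) k = ((Yᵀ * X) * (Yᵀ * X)ᵀ).trace := by
      simp only [rhoX_eq_mul_transpose, Matrix.trace, Matrix.diag_apply]
    rw [h1, h2, Matrix.transpose_mul, Matrix.transpose_mul, Matrix.transpose_transpose,
      Matrix.transpose_transpose, Matrix.mul_assoc, Matrix.trace_mul_comm]
    simp only [Matrix.mul_assoc]
  have hYs := sum_rhoX hY
  have hXs := sum_rhoX hX
  simp only [rhoX_eq_sum_sq hY] at hYs
  simp only [rhoX_eq_sum_sq hX] at hXs
  have hexp : ∑ i, ∑ j, ((Y * Yᵀ) i j - (X * Xᵀ) i j) ^ 2 =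
      ∑ i, ∑ j, (Y * Yᵀ) i j ^ 2 + ∑ i, ∑ j, (X * Xᵀ) i j ^ 2
        - 2 * ∑ i, ∑ j, (Y * Yᵀ) i j * (X * Xᵀ) i j := by
    simp only [Finset.mul_sum, ← Finset.sum_add_distrib, ← Finset.sum_sub_distrib]
    refine Finset.sum_congr rfl fun i _ => Finset.sum_congr rfl fun j _ => by ring
  rw [hexp, hYs, hXs, hcross] at hentry
  linarith

/-- If off-diagonal entries of `ZZᵀ` only couple equal diagonal entries of `diagonal l`, then the
columns of `Z` span an invariant subspace of `diagonal l`. -/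
lemma diagonal_mul_eq_of_commute {n p : ℕ} {Z : Matrix (Fin n) (Fin p) ℝ} (hZ : Zᵀ * Z = 1)
    {l : Fin n → ℝ} (h : ∀ j k, l j = l k ∨ (Z * Zᵀ) j k = 0) :
    diagonal l * Z = Z * (Zᵀ * diagonal l * Z) := by
  have hc : diagonal l * (Z * Zᵀ) = (Z * Zᵀ) * diagonal l := by
    ext j k
    rw [Matrix.diagonal_mul, Matrix.mul_diagonal]
    rcases h j k with h | h
    · rw [h, mul_comm]
    · rw [h, mul_zero, zero_mul]
  calc diagonal l * Z = diagonal l * (Z * Zᵀ) * Z := by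
        rw [Matrix.mul_assoc, Matrix.mul_assoc, hZ, Matrix.mul_one]
    _ = Z * (Zᵀ * diagonal l * Z) := by rw [hc]; simp only [Matrix.mul_assoc]

lemma mul_transpose_apply_eq_zero_of_rhoX {n p : ℕ} {Z : Matrix (Fin n) (Fin p) ℝ}
    (hZ : Zᵀ * Z = 1) {j k : Fin n} (hjk : j ≠ k) (h : rhoX Z j = 0 ∨ rhoX Z j = 1) :
    (Z * Zᵀ) j k = 0 := by
  have hs := rhoX_eq_sum_sq hZ j
  rw [← Finset.add_sum_erase _ _ (Finset.mem_univ j), ← rhoX_eq_mul_transpose] at hs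
  have hle := Finset.single_le_sum (f := fun i => (Z * Zᵀ) j i ^ 2)
    (fun i _ => sq_nonneg _) (Finset.mem_erase.2 ⟨hjk.symm, Finset.mem_univ k⟩)
  have hzero : (Z * Zᵀ) j k ^ 2 ≤ 0 := by
    rcases h with h | h <;> rw [h] at hs <;> linarith
  exact pow_eq_zero_iff two_ne_zero |>.1 (le_antisymm hzero (sq_nonneg _))

/-- Theorem 2.7 of the paper: a global minimizer `X*` of the KS total
energy minimization problem is an orthonormal eigenbasis of `H(X*)` corresponding to its
`p` smallest eigenvalues, provided the eigenvalue gap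
`λ_{p+1}(H(X*)) − λ_p(H(X*)) ≥ δ > p(‖L†‖₂ − γ/3)`. -/
theorem global_minimizer_solves_KS {n p : ℕ} (hp : 1 ≤ p) (hpn : p < n)
    (L Vion Ld : Matrix (Fin n) (Fin n) ℝ)
    (hL : L.IsHermitian) (hVion : Vion.IsHermitian)
    (hMP1 : L * Ld * L = L) (hMP2 : Ld * L * Ld = Ld)
    (hMP3 : (L * Ld)ᵀ = L * Ld) (hMP4 : (Ld * L)ᵀ = Ld * L)
    (γ : ℝ) (hγ : γ = 2 * (3 / Real.pi) ^ ((1 : ℝ) / 3))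
    (X : Matrix (Fin n) (Fin p) ℝ) (hfeas : Xᵀ * X = 1)
    (hmin : ∀ Y : Matrix (Fin n) (Fin p) ℝ, Yᵀ * Y = 1 →
      En L Vion Ld γ X ≤ En L Vion Ld γ Y)
    (δ : ℝ) (hδ : δ > p * (specNorm Ld - γ / 3))
    (hgap : eig (HXmat L Vion Ld γ X) ⟨p, hpn⟩
        - eig (HXmat L Vion Ld γ X) ⟨p - 1, by omega⟩ ≥ δ) :
    HXmat L Vion Ld γ X * X = X * (Xᵀ * HXmat L Vion Ld γ X * X) ∧
    Matrix.trace (Xᵀ * HXmat L Vion Ld γ X * X)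
      = ∑ k : Fin p, eig (HXmat L Vion Ld γ X) (Fin.castLE hpn.le k) := by
  have hLt : Lᵀ = L := hL
  have hVt : Vionᵀ = Vion := hVion
  have hLd := transpose_pseudoinverse_eq hLt hMP1 hMP2 hMP3 hMP4
  have hγ0 : 0 ≤ γ := by rw [hγ]; positivity
  have hH : (HXmat L Vion Ld γ X).IsHermitian := by
    change (HXmat L Vion Ld γ X)ᵀ = _
    simp [HXmat, hLt, hVt]
  have hE := fun Y hY => En_sub_le (L := L) (Vion := Vion) hLd hγ0 (Y := Y) hfeas hY
  generalize HXmat L Vion Ld γ X = H at *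
  obtain ⟨U, hU, hU', hspec⟩ := exists_orthogonal_eig hH
  have hmono := eig_monotone hH
  generalize eig H = l at *
  set Z := Uᵀ * X with hZdef
  have hZ : Zᵀ * Z = 1 := by
    rw [hZdef, transpose_mul, transpose_transpose, Matrix.mul_assoc, ← Matrix.mul_assoc U, hU',
      Matrix.one_mul, hfeas]
  have hXZ : X = U * Z := by rw [hZdef, ← Matrix.mul_assoc, hU', Matrix.one_mul]
  have hXHX : Xᵀ * H * X = Zᵀ * diagonal l * Z := by
    rw [hspec, hZdef, transpose_mul, transpose_transpose]; simp only [Matrix.mul_assoc]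
  have htrX : (Xᵀ * H * X).trace = ∑ k, l k * rhoX Z k := by
    rw [hXHX, trace_transpose_mul_diagonal_mul]
  set c : Fin p → Fin n := Fin.castLE hpn.le with hc
  have hcinj : Function.Injective c := Fin.castLE_injective hpn.le
  set Y := U.submatrix id c
  have hY : Yᵀ * Y = 1 := by
    have : Yᵀ * Y = (Uᵀ * U).submatrix c c := by
      rw [Matrix.submatrix_mul _ _ c id c Function.bijective_id]; rfl
    rw [this, hU, Matrix.submatrix_one _ hcinj]
  have htrY : (Yᵀ * H * Y).trace = ∑ k, l (c k) := by
    have : Yᵀ * H * Y = (Uᵀ * H * U).submatrix c c := by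
      rw [Matrix.submatrix_mul _ _ c id c Function.bijective_id,
        Matrix.submatrix_mul _ _ c id id Function.bijective_id]; rfl
    have hd : Uᵀ * H * U = diagonal l := by
      rw [hspec, Matrix.mul_assoc, Matrix.mul_assoc, Matrix.mul_assoc, hU, Matrix.mul_one,
        ← Matrix.mul_assoc, hU, Matrix.one_mul]
    rw [this, hd]; simp [Matrix.trace]
  have hYX : ∀ k, rhoX (Yᵀ * X) k = rhoX Z (c k) := fun k => by
    have : Yᵀ * X = Z.submatrix c id := by
      rw [hZdef, Matrix.submatrix_mul _ _ c id id Function.bijective_id]; rfl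
    rw [this]; rfl
  set a := l ⟨p - 1, by omega⟩
  set b := l ⟨p, hpn⟩
  have hab : a ≤ b := hmono (by simp [Fin.le_def])
  have hla : ∀ k : Fin n, (k : ℕ) < p → l k ≤ a := fun k hk => hmono (by simp [Fin.le_def]; omega)
  have hlb : ∀ k : Fin n, ¬ (k : ℕ) < p → b ≤ l k := fun k hk =>
    hmono (by simpa [Fin.le_def] using hk)
  have hexc := weighted_sum_sub_sum_smallest hpn l (rhoX Z) a b (sum_rhoX hZ)
  have hT : ∀ k : Fin n, k ∈ Finset.univ → 0 ≤ if (k : ℕ) < p then (a - l k) * (1 - rhoX Z k)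
      else (l k - b) * rhoX Z k := fun k _ => by
    split_ifs with hk
    · exact mul_nonneg (sub_nonneg.2 (hla k hk)) (sub_nonneg.2 (rhoX_le_one hZ k))
    · exact mul_nonneg (sub_nonneg.2 (hlb k hk)) (rhoX_nonneg Z k)
  have hT0 := Finset.sum_nonneg hT
  have hd := sum_sq_rhoX_sub_le hfeas hY
  simp only [hYX] at hd
  have hd0 : 0 ≤ ∑ i, (rhoX Y i - rhoX X i) ^ 2 := Finset.sum_nonneg fun i _ => sq_nonneg _
  have hEY := hE Y hY
  have hXY := hmin Y hY
  rw [htrX, htrY] at hEY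
  set s : ℝ := p - ∑ k : Fin p, rhoX Z (c k) with hs
  set T := ∑ k : Fin n, if (k : ℕ) < p then (a - l k) * (1 - rhoX Z k)
      else (l k - b) * rhoX Z k
  set q := ∑ i, (rhoX Y i - rhoX X i) ^ 2
  have hs0 : 0 ≤ s := by linarith
  have hbas : 0 ≤ (b - a) * s := mul_nonneg (sub_nonneg.2 hab) hs0
  have hineq : 2 * (T + (b - a) * s) ≤ (specNorm Ld - γ / 3) * q := by
    rw [← hexc]; linarith
  have hp1 : (1 : ℝ) ≤ p := by exact_mod_cast hp
  obtain ⟨hTz, hsz⟩ : T = 0 ∧ (b - a) * s = 0 := by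
    rcases le_total (specNorm Ld - γ / 3) 0 with hneg | hpos
    · have := mul_nonpos_of_nonpos_of_nonneg hneg hd0
      constructor <;> linarith
    · have hgt : specNorm Ld - γ / 3 < b - a := by nlinarith
      have h1 := mul_le_mul_of_nonneg_left hd hpos
      have h2 : s = 0 := by
        by_contra hne
        have := mul_lt_mul_of_pos_right hgt (lt_of_le_of_ne hs0 (Ne.symm hne))
        linarith
      rw [h2] at h1 hineq ⊢
      constructor <;> linarith
  constructor
  · have hterm := (Finset.sum_eq_zero_iff_of_nonneg hT).1 hTz
    have hcases : ∀ k, l k = a ∨ (rhoX Z k = 0 ∨ rhoX Z k = 1) := by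
      intro k
      by_cases hsne : s = 0
      · -- When `s = 0` the excess identity may be used with strictly separated thresholds.
        have hexc' := weighted_sum_sub_sum_smallest hpn l (rhoX Z) (a + 1) (b - 1) (sum_rhoX hZ)
        rw [hexc, hsz, hTz, ← hc, ← hs, hsne, mul_zero] at hexc'
        have hT' : ∀ k : Fin n, k ∈ Finset.univ → 0 ≤ if (k : ℕ) < p then
            (a + 1 - l k) * (1 - rhoX Z k) else (l k - (b - 1)) * rhoX Z k := fun k _ => by
          split_ifs with hk
          · exact mul_nonneg (by linarith [hla k hk]) (sub_nonneg.2 (rhoX_le_one hZ k))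
          · exact mul_nonneg (by linarith [hlb k hk]) (rhoX_nonneg Z k)
        have h := (Finset.sum_eq_zero_iff_of_nonneg hT').1 (by linarith) k (Finset.mem_univ k)
        right
        split_ifs at h with hk
        · rcases mul_eq_zero.1 h with h | h
          · linarith [hla k hk]
          · right; linarith
        · rcases mul_eq_zero.1 h with h | h
          · linarith [hlb k hk]
          · exact Or.inl h
      · have hba : b - a = 0 := (mul_eq_zero.1 hsz).resolve_right hsne
        have h := hterm k (Finset.mem_univ k)
        split_ifs at h with hk
        · rcases mul_eq_zero.1 h with h | h
          · left; linarith
          · right; right; linarith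
        · rcases mul_eq_zero.1 h with h | h
          · left; linarith
          · exact Or.inr (Or.inl h)
    have hinv : diagonal l * Z = Z * (Zᵀ * diagonal l * Z) := by
      refine diagonal_mul_eq_of_commute hZ fun j k => ?_
      rcases eq_or_ne j k with rfl | hjk
      · exact Or.inl rfl
      rcases hcases j with hj | hj
      · rcases hcases k with hk | hk
        · exact Or.inl (hj.trans hk.symm)
        · right
          have hsymm : (Z * Zᵀ)ᵀ = Z * Zᵀ := by simp
          rw [← hsymm, Matrix.transpose_apply]
          exact mul_transpose_apply_eq_zero_of_rhoX hZ hjk.symm hk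
      · exact Or.inr (mul_transpose_apply_eq_zero_of_rhoX hZ hjk hj)
    calc H * X = U * (diagonal l * Z) := by rw [hspec, hZdef]; simp only [Matrix.mul_assoc]
      _ = X * (Xᵀ * H * X) := by rw [hinv, hXHX, ← Matrix.mul_assoc, ← hXZ]
  · rw [htrX]
    linarith
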